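/- arXiv:1003.0267 — 3 statements merged into one kernel-verified Lean document; each statement's English description precedes it below -/
import Mathlib

section
/- Let d ≥ 2, R̄ = ℂ[x]/(x^d), and 1 ≤ j ≤ d-1. Let Ā_j denote the group of special R̄-automorphisms of R̄[z,t] (Jacobian determinant a nonzero constant) congruent to the identity mod (x^j). The map Φ_j : Ā_j → (z,t) ⊂ ℂ[z,t] sending φ to the unique h ∈ (z,t) with φ(z) ≡ z + h_t·x^j and φ(t) ≡ t - h_z·x^j mod (x^{j+1}) is a surjective group homomorphism with kernel Ā_{j+1}, and hence Ā_j/Ā_{j+1} is isomorphic to the additive group of the ideal (z,t) ⊂ ℂ[z,t]. -/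
open MvPolynomial

/-- The Poisson bracket / Jacobian pairing on `ℂ[x,z,t]` with respect to `z`
(index 1) and `t` (index 2). -/
noncomputable def pb (f g : MvPolynomial (Fin 3) ℂ) : MvPolynomial (Fin 3) ℂ :=
  pderiv 1 f * pderiv 2 g - pderiv 2 f * pderiv 1 g

/-- The ideal `(x^d)` of `ℂ[x,z,t]`. -/
noncomputable def Idl (d : ℕ) : Ideal (MvPolynomial (Fin 3) ℂ) :=
  Ideal.span {(X 0 : MvPolynomial (Fin 3) ℂ) ^ d}

/-- `R̄[z,t] = (ℂ[x]/(x^d))[z,t] = ℂ[x,z,t]/(x^d)`. -/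
abbrev Qr (d : ℕ) := MvPolynomial (Fin 3) ℂ ⧸ Idl d

/-- The quotient map `ℂ[x,z,t] → R̄[z,t]`. -/
noncomputable def qk (d : ℕ) : MvPolynomial (Fin 3) ℂ →ₐ[ℂ] Qr d :=
  Ideal.Quotient.mkₐ ℂ (Idl d)

/-- Membership in `Ā_j` : `φ` is an `R̄`-automorphism of `R̄[z,t]` (it fixes
`x`), it is special (its Jacobian determinant is a nonzero constant), and
`φ ≡ id mod (x^j)`. -/
def MemA (d j : ℕ) (φ : Qr d ≃ₐ[ℂ] Qr d) : Prop :=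
  φ (qk d (X 0)) = qk d (X 0) ∧
  ∃ p q : MvPolynomial (Fin 3) ℂ,
    φ (qk d (X 1)) = qk d p ∧ φ (qk d (X 2)) = qk d q ∧
    (∃ c : ℂ, c ≠ 0 ∧ pb p q - C c ∈ Idl d) ∧
    p - X 1 ∈ Ideal.span {(X 0 : MvPolynomial (Fin 3) ℂ) ^ j} ∧
    q - X 2 ∈ Ideal.span {(X 0 : MvPolynomial (Fin 3) ℂ) ^ j}

/-- `Φ_j(φ) = h` : `h ∈ (z,t) ⊂ ℂ[z,t]` and `φ(z) ≡ z + h_t·x^j`,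
`φ(t) ≡ t - h_z·x^j` modulo `(x^{j+1})`. -/
def RelPhi (d j : ℕ) (φ : Qr d ≃ₐ[ℂ] Qr d) (h : MvPolynomial (Fin 3) ℂ) : Prop :=
  pderiv 0 h = 0 ∧ constantCoeff h = 0 ∧
  ∃ p q : MvPolynomial (Fin 3) ℂ,
    φ (qk d (X 1)) = qk d p ∧ φ (qk d (X 2)) = qk d q ∧
    p - (X 1 + pderiv 2 h * X 0 ^ j) ∈
      Ideal.span {(X 0 : MvPolynomial (Fin 3) ℂ) ^ (j + 1)} ∧
    q - (X 2 - pderiv 1 h * X 0 ^ j) ∈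
      Ideal.span {(X 0 : MvPolynomial (Fin 3) ℂ) ^ (j + 1)}

/-- Shorthand for `ℂ[x,z,t]`. -/
abbrev P3 := MvPolynomial (Fin 3) ℂ

lemma pd_comm (i k : Fin 3) (f : P3) : pderiv i (pderiv k f) = pderiv k (pderiv i f) := by
  have : ⁅(pderiv i : Derivation ℂ P3 P3), (pderiv k : Derivation ℂ P3 P3)⁆ = 0 := by
    apply derivation_ext
    intro l
    simp only [Derivation.commutator_apply, pderiv_X, Derivation.zero_apply, Pi.single_apply]
    split_ifs <;> simp
  have h2 := congrArg (fun D : Derivation ℂ P3 P3 => D f) this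
  simpa [Derivation.commutator_apply, sub_eq_zero] using h2

/-- Setting `x = 0`. -/
noncomputable def ev0 : P3 →ₐ[ℂ] P3 := aeval ![0, X 1, X 2]

lemma ev0_X0 : ev0 (X 0) = 0 := by simp [ev0]
lemma ev0_X1 : ev0 (X 1) = X 1 := by simp [ev0]
lemma ev0_X2 : ev0 (X 2) = X 2 := by simp [ev0]

lemma ev0_dvd (f : P3) : X 0 ∣ f - ev0 f := by
  induction f using MvPolynomial.induction_on with
  | C a => simp [ev0]
  | add p q hp hq =>
    rw [map_add, add_sub_add_comm]; exact dvd_add hp hq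
  | mul_X p i hp =>
    have : X 0 ∣ (X i : P3) - ev0 (X i) := by
      fin_cases i <;> simp [ev0]
    rw [map_mul, show p * X i - ev0 p * ev0 (X i) =
      (p - ev0 p) * X i + ev0 p * (X i - ev0 (X i)) by ring]
    exact dvd_add (hp.mul_right _) (this.mul_left _)

lemma ev0_of_dvd {f : P3} (h : X 0 ∣ f) : ev0 f = 0 := by
  obtain ⟨g, rfl⟩ := h
  simp [ev0_X0]

lemma pd0_ev0 (f : P3) : pderiv 0 (ev0 f) = 0 := by
  induction f using MvPolynomial.induction_on with
  | C a => simp [ev0]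
  | add p q hp hq => simp [hp, hq]
  | mul_X p i hp =>
    have : pderiv 0 (ev0 (X i : P3)) = 0 := by
      fin_cases i <;> simp [ev0, pderiv_X]
    simp [pderiv_mul, hp, this]

lemma pd_ev0 {i : Fin 3} (hi : i ≠ 0) (f : P3) : pderiv i (ev0 f) = ev0 (pderiv i f) := by
  induction f using MvPolynomial.induction_on with
  | C a => simp [ev0]
  | add p q hp hq => simp [hp, hq]
  | mul_X p k hp =>
    have : pderiv i (ev0 (X k : P3)) = ev0 (pderiv i (X k)) := by
      fin_cases i <;> fin_cases k <;> simp_all [ev0, pderiv_X]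
    simp only [pderiv_mul, map_mul, map_add, hp, this]

lemma eq_zero_of_X0_dvd {f : P3} (h : X 0 ∣ f) (h0 : pderiv 0 f = 0) : f = 0 := by
  ext m
  by_cases hm : m 0 = 0
  · obtain ⟨g, rfl⟩ := h
    rw [coeff_X_mul']
    simp [hm]
  · have := congrArg (coeff (m - Finsupp.single 0 1)) h0
    rw [coeff_pderiv] at this
    have e : m - Finsupp.single 0 1 + Finsupp.single 0 1 = m := by
      apply tsub_add_cancel_of_le
      simpa [Finsupp.single_le_iff] using Nat.one_le_iff_ne_zero.2 hm
    rw [e] at this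
    simp only [coeff_zero, mul_eq_zero] at this
    rcases this with h | h
    · simpa using h
    · exfalso
      norm_cast at h

lemma eq_zero_of_pd {f : P3} (h : ∀ i, pderiv i f = 0) (h0 : constantCoeff f = 0) : f = 0 := by
  ext m
  by_cases hm : m = 0
  · subst hm; simpa [constantCoeff_eq] using h0
  · obtain ⟨i, hi⟩ := Finsupp.ne_iff.1 hm
    have := congrArg (coeff (m - Finsupp.single i 1)) (h i)
    rw [coeff_pderiv] at this
    have e : m - Finsupp.single i 1 + Finsupp.single i 1 = m := by
      apply tsub_add_cancel_of_le
      simpa [Finsupp.single_le_iff] using Nat.one_le_iff_ne_zero.2 hi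
    rw [e] at this
    simp only [coeff_zero, mul_eq_zero] at this
    rcases this with h | h
    · simpa using h
    · exfalso
      norm_cast at h

/-- Antiderivative in the variable `i`. -/
noncomputable def anti (i : Fin 3) : P3 →ₗ[ℂ] P3 :=
  (basisMonomials (Fin 3) ℂ).constr ℂ
    (fun m => monomial (m + Finsupp.single i 1) ((m i + 1 : ℂ)⁻¹))

lemma anti_mon (i : Fin 3) (m : Fin 3 →₀ ℕ) :
    anti i (monomial m 1) = monomial (m + Finsupp.single i 1) ((m i + 1 : ℂ)⁻¹) := by
  have := (basisMonomials (Fin 3) ℂ).constr_basis ℂ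
    (fun m => (monomial (m + Finsupp.single i 1) ((m i + 1 : ℂ)⁻¹) : P3)) m
  simpa [anti] using this

lemma anti_mon' (i : Fin 3) (m : Fin 3 →₀ ℕ) (c : ℂ) :
    anti i (monomial m c) = monomial (m + Finsupp.single i 1) (c * (m i + 1 : ℂ)⁻¹) := by
  have : (monomial m c : P3) = c • monomial m 1 := by simp [smul_monomial]
  rw [this, map_smul, anti_mon, smul_monomial, smul_eq_mul]

lemma pd_anti (i : Fin 3) (f : P3) : pderiv i (anti i f) = f := by
  induction f using MvPolynomial.induction_on' with
  | monomial m c =>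
    rw [anti_mon', pderiv_monomial]
    have : (m i + 1 : ℂ) ≠ 0 := by norm_cast
    simp [this]
  | add p q hp hq => simp [hp, hq]

lemma pd_anti_comm {i k : Fin 3} (hik : k ≠ i) (f : P3) :
    pderiv k (anti i f) = anti i (pderiv k f) := by
  induction f using MvPolynomial.induction_on' with
  | monomial m c =>
    rw [anti_mon', pderiv_monomial, pderiv_monomial, anti_mon']
    by_cases hm : m k = 0
    · simp [hm, hik, Finsupp.single_apply, hik.symm]
    · congr 1
      · congr 1
        ext l
        by_cases h1 : l = k <;> by_cases h2 : l = i <;>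
          simp_all [Finsupp.single_apply, eq_comm]
      · simp [hik, hik.symm, Finsupp.single_apply]; ring
  | add p q hp hq => simp [hp, hq]

lemma poincare {a b : P3} (ha : pderiv 0 a = 0) (hb : pderiv 0 b = 0)
    (hab : pderiv 1 a + pderiv 2 b = 0) :
    ∃ h : P3, pderiv 0 h = 0 ∧ constantCoeff h = 0 ∧ pderiv 2 h = a ∧ pderiv 1 h = - b := by
  set h0 := anti 2 a with hh0
  set k := anti 1 (- b - pderiv 1 h0) with hk
  have e1 : pderiv 0 h0 = 0 := by rw [hh0, pd_anti_comm (by decide), ha, map_zero]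
  have e2 : pderiv 2 h0 = a := pd_anti _ _
  have e3 : pderiv 1 k = - b - pderiv 1 h0 := pd_anti _ _
  have e4 : pderiv 0 k = 0 := by
    rw [hk, pd_anti_comm (by decide), map_sub, map_neg, hb, pd_comm, e1]; simp
  have e5 : pderiv 2 k = 0 := by
    rw [hk, pd_anti_comm (by decide), map_sub, map_neg, pd_comm, e2,
      show - pderiv 2 b - pderiv 1 a = -(pderiv 1 a + pderiv 2 b) by ring, hab]; simp
  refine ⟨h0 + k - C (constantCoeff (h0 + k)), ?_, ?_, ?_, ?_⟩
  · simp [e1, e4]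
  · simp
  · simp [e2, e5]
  · simp [e3]

lemma qk_eq {d : ℕ} {f g : P3} : qk d f = qk d g ↔ X 0 ^ d ∣ f - g := by
  rw [qk, Ideal.Quotient.mkₐ_eq_mk, Ideal.Quotient.eq, Idl, Ideal.mem_span_singleton]

lemma qk_surj (d : ℕ) : Function.Surjective (qk d) := Ideal.Quotient.mkₐ_surjective _ _

lemma memA_apply {d j : ℕ} {φ : Qr d ≃ₐ[ℂ] Qr d} (hφ : MemA d j φ) (f : P3) :
    ∃ g : P3, φ (qk d f) = qk d (f + X 0 ^ j * g) := by
  obtain ⟨h0, p, q, hp, hq, -, hpj, hqj⟩ := hφ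
  rw [Ideal.mem_span_singleton] at hpj hqj
  obtain ⟨a, ha⟩ := hpj
  obtain ⟨b, hb⟩ := hqj
  have hX : ∀ i, ∃ g : P3, φ (qk d (X i)) = qk d (X i + X 0 ^ j * g) := by
    intro i
    fin_cases i
    · exact ⟨0, by simpa using h0⟩
    · exact ⟨a, by rw [← ha]; simpa using hp⟩
    · exact ⟨b, by rw [← hb]; simpa using hq⟩
  induction f using MvPolynomial.induction_on with
  | C c =>
    refine ⟨0, ?_⟩
    have : (C c : P3) = algebraMap ℂ P3 c := rfl
    rw [this, mul_zero, add_zero, AlgHom.commutes, AlgEquiv.commutes]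
  | add f1 f2 hf1 hf2 =>
    obtain ⟨g1, h1⟩ := hf1
    obtain ⟨g2, h2⟩ := hf2
    refine ⟨g1 + g2, ?_⟩
    rw [map_add, map_add, h1, h2, ← map_add]
    congr 1; ring
  | mul_X f i hf =>
    obtain ⟨g1, h1⟩ := hf
    obtain ⟨g2, h2⟩ := hX i
    refine ⟨g1 * X i + f * g2 + X 0 ^ j * g1 * g2, ?_⟩
    rw [map_mul, map_mul, h1, h2, ← map_mul]
    congr 1; ring

lemma rel_z {d j : ℕ} (hjd : j + 1 ≤ d) {u : Qr d} {p p' r : P3} (h1 : u = qk d p)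
    (h2 : u = qk d p') (h : X 0 ^ (j + 1) ∣ p - r) : X 0 ^ (j + 1) ∣ p' - r := by
  have h3 : X 0 ^ d ∣ p' - p := qk_eq.1 (h2.symm.trans h1)
  have : p' - r = (p' - p) + (p - r) := by ring
  rw [this]
  exact dvd_add ((pow_dvd_pow _ hjd).trans h3) h

lemma cancel_x {j : ℕ} {f : P3} (h : X 0 ^ (j + 1) ∣ f * X 0 ^ j) : X 0 ∣ f := by
  rw [pow_succ', mul_dvd_mul_iff_right (pow_ne_zero _ (X_ne_zero _))] at h
  exact h

lemma pd0_pd {h : P3} (h0 : pderiv 0 h = 0) (i : Fin 3) : pderiv 0 (pderiv i h) = 0 := by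
  rw [pd_comm, h0, map_zero]

lemma relPhi_unique {d j : ℕ} (hjd : j + 1 ≤ d) {φ : Qr d ≃ₐ[ℂ] Qr d} {h h' : P3}
    (H : RelPhi d j φ h) (H' : RelPhi d j φ h') : h = h' := by
  obtain ⟨a0, a1, p, q, hp, hq, e1, e2⟩ := H
  obtain ⟨b0, b1, p', q', hp', hq', e1', e2'⟩ := H'
  rw [Ideal.mem_span_singleton] at e1 e2 e1' e2'
  have f1 := dvd_sub (rel_z hjd hp' hp e1') e1
  have f2 := dvd_sub e2 (rel_z hjd hq' hq e2')
  have g1 : pderiv 2 (h - h') = 0 := by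
    apply eq_zero_of_X0_dvd
    · apply cancel_x (j := j)
      convert f1 using 1
      rw [map_sub]; ring
    · apply pd0_pd; rw [map_sub, a0, b0, sub_zero]
  have g2 : pderiv 1 (h - h') = 0 := by
    apply eq_zero_of_X0_dvd
    · apply cancel_x (j := j)
      convert f2 using 1
      rw [map_sub]; ring
    · apply pd0_pd; rw [map_sub, a0, b0, sub_zero]
  rw [← sub_eq_zero]
  apply eq_zero_of_pd
  · intro i
    fin_cases i
    · simp [a0, b0]
    · exact g2
    · exact g1
  · rw [map_sub, a1, b1, sub_zero]

lemma pd_xpow {i : Fin 3} (hi : i ≠ 0) (n : ℕ) (a : P3) :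
    pderiv i (X 0 ^ n * a) = X 0 ^ n * pderiv i a := by
  rw [pderiv_mul, pderiv_pow, pderiv_X_of_ne hi.symm]; ring

lemma relPhi_exists {d j : ℕ} (hj : 1 ≤ j) (hjd : j + 1 ≤ d) {φ : Qr d ≃ₐ[ℂ] Qr d}
    (H : MemA d j φ) : ∃ h, RelPhi d j φ h := by
  obtain ⟨h0, p, q, hp, hq, ⟨c, hc, hpb⟩, hpj, hqj⟩ := H
  rw [Ideal.mem_span_singleton] at hpj hqj
  rw [Idl, Ideal.mem_span_singleton] at hpb
  obtain ⟨a, ha⟩ := hpj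
  obtain ⟨b, hb⟩ := hqj
  obtain rfl : p = X 1 + X 0 ^ j * a := by rw [← ha]; ring
  obtain rfl : q = X 2 + X 0 ^ j * b := by rw [← hb]; ring
  have key : pb (X 1 + X 0 ^ j * a) (X 2 + X 0 ^ j * b) =
      1 + (pderiv 1 a + pderiv 2 b + X 0 ^ j * pb a b) * X 0 ^ j := by
    simp only [pb, map_add, pd_xpow (show (1 : Fin 3) ≠ 0 by decide),
      pd_xpow (show (2 : Fin 3) ≠ 0 by decide), pderiv_X_self,
      pderiv_X_of_ne (show (2 : Fin 3) ≠ 1 by decide),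
      pderiv_X_of_ne (show (1 : Fin 3) ≠ 2 by decide)]
    ring
  rw [key] at hpb
  have hxj : ev0 (X 0 ^ j) = 0 := by rw [map_pow, ev0_X0, zero_pow (by omega)]
  have hc1 : c = 1 := by
    have := ev0_of_dvd ((dvd_pow_self (X 0 : P3) (show d ≠ 0 by omega)).trans hpb)
    rw [map_sub, map_add, map_mul, hxj, mul_zero, map_one, add_zero] at this
    have e : ev0 (C c) = C c := by simp [ev0]
    rw [e, sub_eq_zero, ← C_1] at this
    exact (C_injective _ _ this).symm
  subst hc1
  rw [C_1, add_sub_cancel_left] at hpb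
  have h2 := ev0_of_dvd (cancel_x ((pow_dvd_pow _ hjd).trans hpb))
  rw [map_add, map_mul, hxj, zero_mul, add_zero, map_add, ← pd_ev0 (by decide),
    ← pd_ev0 (by decide)] at h2
  obtain ⟨h, e0, e1, e2, e3⟩ := poincare (pd0_ev0 a) (pd0_ev0 b) h2
  refine ⟨h, e0, e1, _, _, hp, hq, ?_, ?_⟩
  · rw [Ideal.mem_span_singleton, e2, show X 1 + X 0 ^ j * a - (X 1 + ev0 a * X 0 ^ j) =
      X 0 ^ j * (a - ev0 a) by ring, pow_succ]
    exact mul_dvd_mul_left _ (ev0_dvd a)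
  · rw [Ideal.mem_span_singleton, e3, show X 2 + X 0 ^ j * b - (X 2 - -ev0 b * X 0 ^ j) =
      X 0 ^ j * (b - ev0 b) by ring, pow_succ]
    exact mul_dvd_mul_left _ (ev0_dvd b)

lemma phi_step {d j : ℕ} (hj : 1 ≤ j) {φ : Qr d ≃ₐ[ℂ] Qr d} (hφ : MemA d j φ) (i : Fin 3)
    {u v p p' : P3} (hp : φ (qk d (X i)) = qk d p)
    (e : X 0 ^ (j + 1) ∣ p - (X i + u * X 0 ^ j))
    (e' : X 0 ^ (j + 1) ∣ p' - (X i + v * X 0 ^ j)) :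
    ∃ r, φ (qk d p') = qk d r ∧ X 0 ^ (j + 1) ∣ r - (X i + (u + v) * X 0 ^ j) := by
  obtain ⟨w, hw⟩ := e'
  obtain ⟨v', hv'⟩ := memA_apply hφ v
  obtain ⟨w', hw'⟩ := memA_apply hφ w
  have hp' : p' = X i + v * X 0 ^ j + X 0 ^ (j + 1) * w := by rw [← hw]; ring
  have hx : φ (qk d (X 0)) = qk d (X 0) := hφ.1
  refine ⟨p + (v + X 0 ^ j * v') * X 0 ^ j + X 0 ^ (j + 1) * (w + X 0 ^ j * w'), ?_, ?_⟩
  · rw [hp']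
    simp only [map_add, map_mul, map_pow] at hv' hw' ⊢
    rw [hp, hx, hv', hw']
  · rw [show p + (v + X 0 ^ j * v') * X 0 ^ j + X 0 ^ (j + 1) * (w + X 0 ^ j * w') -
      (X i + (u + v) * X 0 ^ j) = (p - (X i + u * X 0 ^ j)) + (X 0 ^ (j + j) * v' +
        X 0 ^ (j + 1) * (w + X 0 ^ j * w')) by ring]
    exact dvd_add e (dvd_add ((pow_dvd_pow _ (by omega)).mul_right _) (dvd_mul_right _ _))

lemma relPhi_mul {d j : ℕ} (hj : 1 ≤ j) {φ ψ : Qr d ≃ₐ[ℂ] Qr d} {h h' : P3}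
    (hφ : MemA d j φ) (H : RelPhi d j φ h) (H' : RelPhi d j ψ h') :
    RelPhi d j (φ * ψ) (h + h') := by
  obtain ⟨a0, a1, p, q, hp, hq, e1, e2⟩ := H
  obtain ⟨b0, b1, p', q', hp', hq', e1', e2'⟩ := H'
  rw [Ideal.mem_span_singleton] at e1 e2 e1' e2'
  rw [sub_eq_add_neg (X 2), ← neg_mul] at e2 e2'
  obtain ⟨r, hr, hr'⟩ := phi_step hj hφ 1 hp e1 e1'
  obtain ⟨s, hs, hs'⟩ := phi_step hj hφ 2 hq e2 e2'
  refine ⟨by rw [map_add, a0, b0, add_zero], by rw [map_add, a1, b1, add_zero], r, s, ?_, ?_,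
    ?_, ?_⟩
  · rw [AlgEquiv.mul_apply, hp', hr]
  · rw [AlgEquiv.mul_apply, hq', hs]
  · rw [Ideal.mem_span_singleton, map_add]; exact hr'
  · rw [Ideal.mem_span_singleton, map_add]
    convert hs' using 2
    ring

lemma relPhi_ker {d j : ℕ} (hjd : j + 1 ≤ d) {φ : Qr d ≃ₐ[ℂ] Qr d} {h : P3}
    (hφ : MemA d j φ) (H : RelPhi d j φ h) : h = 0 ↔ MemA d (j + 1) φ := by
  constructor
  · rintro rfl
    obtain ⟨-, -, p, q, hp, hq, e1, e2⟩ := H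
    obtain ⟨h0, p', q', hp', hq', hc, -, -⟩ := hφ
    rw [Ideal.mem_span_singleton] at e1 e2
    refine ⟨h0, p', q', hp', hq', hc, ?_, ?_⟩
    · rw [Ideal.mem_span_singleton]
      simpa using rel_z hjd hp hp' e1
    · rw [Ideal.mem_span_singleton]
      simpa using rel_z hjd hq hq' e2
  · rintro ⟨-, p, q, hp, hq, -, e1, e2⟩
    refine relPhi_unique hjd H ⟨map_zero _, map_zero _, p, q, hp, hq, ?_, ?_⟩
    · simpa using e1
    · simpa using e2

open IsNilpotent TensorProduct in
lemma exp_bilin {B : Type*} [AddCommGroup B] [Module ℂ B] [Module ℚ B]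
    (D : Module.End ℂ B) (m : B →ₗ[ℂ] B →ₗ[ℂ] B)
    (h_der : ∀ x y, D (m x y) = m x (D y) + m (D x) y)
    (h_nil : IsNilpotent D) (x y : B) :
    IsNilpotent.exp D (m x y) = m (IsNilpotent.exp D x) (IsNilpotent.exp D y) := by
  let DL : Module.End ℂ (B ⊗[ℂ] B) := D.lTensor B
  let DR : Module.End ℂ (B ⊗[ℂ] B) := D.rTensor B
  have h_nilL : IsNilpotent DL := h_nil.map <| Module.End.lTensorAlgHom ℂ B B
  have h_nilR : IsNilpotent DR := h_nil.map <| Module.End.rTensorAlgHom ℂ B B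
  have h_comm : Commute DL DR := by ext; simp [DL, DR]
  set M : B ⊗[ℂ] B →ₗ[ℂ] B := TensorProduct.lift m with hm
  have h₁ : exp D (m x y) = M (exp (DL + DR) (x ⊗ₜ[ℂ] y)) := by
    suffices exp D ∘ₗ M = M ∘ₗ exp (DL + DR) by
      simpa [hm] using! LinearMap.congr_fun this (x ⊗ₜ[ℂ] y)
    apply Module.End.commute_exp_left_of_commute (h_comm.isNilpotent_add h_nilL h_nilR) h_nil
    ext
    simp [DL, DR, hm, h_der]
  have h₂ : exp DL = (exp D).lTensor B := (h_nil.map_exp (Module.End.lTensorAlgHom ℂ B B)).symm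
  have h₃ : exp DR = (exp D).rTensor B := (h_nil.map_exp (Module.End.rTensorAlgHom ℂ B B)).symm
  simp [h₁, exp_add_of_commute h_comm h_nilL h_nilR, h₂, h₃, hm]

/-- The Poisson bracket as a bilinear map. -/
noncomputable def pbL : P3 →ₗ[ℂ] P3 →ₗ[ℂ] P3 :=
  LinearMap.mk₂ ℂ pb
    (by intro a b c; simp only [pb, map_add]; ring)
    (by intro a b c; simp only [pb, Derivation.map_smul, smul_mul_assoc, smul_sub])
    (by intro a b c; simp only [pb, map_add]; ring)
    (by intro a b c; simp only [pb, Derivation.map_smul, mul_smul_comm, smul_sub])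

lemma pbL_apply (f g : P3) : pbL f g = pb f g := rfl

lemma pb_xl (n : ℕ) (f g : P3) : pb (X 0 ^ n * f) g = X 0 ^ n * pb f g := by
  simp only [pb, pd_xpow (show (1 : Fin 3) ≠ 0 by decide),
      pd_xpow (show (2 : Fin 3) ≠ 0 by decide)]
  ring

lemma pb_xr (n : ℕ) (f g : P3) : pb f (X 0 ^ n * g) = X 0 ^ n * pb f g := by
  simp only [pb, pd_xpow (show (1 : Fin 3) ≠ 0 by decide),
      pd_xpow (show (2 : Fin 3) ≠ 0 by decide)]
  ring

/-- The derivation `x^j {·, h}` of `ℂ[x,z,t]`. -/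
noncomputable def DP (j : ℕ) (h : P3) : Module.End ℂ P3 :=
  LinearMap.mulLeft ℂ (X 0 ^ j) ∘ₗ pbL.flip h

lemma DP_apply (j : ℕ) (h f : P3) : DP j h f = X 0 ^ j * pb f h := rfl

lemma DP_mul (j : ℕ) (h f g : P3) : DP j h (f * g) = f * DP j h g + DP j h f * g := by
  simp only [DP_apply, pb, pderiv_mul]; ring

lemma DP_pb (j : ℕ) (h f g : P3) : DP j h (pb f g) = pb f (DP j h g) + pb (DP j h f) g := by
  simp only [DP_apply, pb_xl, pb_xr]
  simp only [pb, pderiv_mul, map_sub]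
  rw [pd_comm 2 1 f, pd_comm 2 1 g, pd_comm 2 1 h]
  ring

lemma DP_pow_dvd (j : ℕ) (h f : P3) (n : ℕ) : X 0 ^ (j * n) ∣ (DP j h ^ n) f := by
  induction n with
  | zero => simp
  | succ n ih =>
    obtain ⟨g, hg⟩ := ih
    rw [pow_succ', Module.End.mul_apply, hg, DP_apply, pb_xl, ← mul_assoc, ← pow_add]
    exact (pow_dvd_pow _ (by rw [mul_add]; omega)).mul_right _

lemma qk_zero {d : ℕ} {f : P3} : qk d f = 0 ↔ X 0 ^ d ∣ f := by
  rw [← map_zero (qk d), qk_eq, sub_zero]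

lemma exists_DQ (d j : ℕ) (h : P3) :
    ∃ D : Module.End ℂ (Qr d), ∀ f, D (qk d f) = qk d (DP j h f) := by
  obtain ⟨s, hs⟩ := (qk d).toLinearMap.exists_rightInverse_of_surjective
    (LinearMap.range_eq_top.2 (qk_surj d))
  refine ⟨(qk d).toLinearMap ∘ₗ DP j h ∘ₗ s, fun f => ?_⟩
  have h1 : qk d (s (qk d f)) = qk d f := LinearMap.congr_fun hs (qk d f)
  obtain ⟨g, hg⟩ := qk_eq.1 h1
  change qk d (DP j h (s (qk d f))) = _
  rw [qk_eq, ← map_sub, hg, DP_apply, pb_xl]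
  exact Dvd.dvd.mul_left (dvd_mul_right _ _) _

lemma exists_pbQ (d : ℕ) :
    ∃ m : Qr d →ₗ[ℂ] Qr d →ₗ[ℂ] Qr d, ∀ f g, m (qk d f) (qk d g) = qk d (pb f g) := by
  obtain ⟨s, hs⟩ := (qk d).toLinearMap.exists_rightInverse_of_surjective
    (LinearMap.range_eq_top.2 (qk_surj d))
  refine ⟨(pbL.compl₁₂ s s).compr₂ (qk d).toLinearMap, fun f g => ?_⟩
  have h1 : ∀ f, qk d (s (qk d f)) = qk d f := fun f => LinearMap.congr_fun hs (qk d f)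
  obtain ⟨u, hu⟩ := qk_eq.1 (h1 f)
  obtain ⟨v, hv⟩ := qk_eq.1 (h1 g)
  change qk d (pbL (s (qk d f)) (s (qk d g))) = _
  rw [qk_eq, show s (qk d f) = f + X 0 ^ d * u by rw [← hu]; ring,
    show s (qk d g) = g + X 0 ^ d * v by rw [← hv]; ring, ← pbL_apply f g]
  simp only [map_add, LinearMap.add_apply, pbL_apply, pb_xl, pb_xr]
  rw [show pb f g + X 0 ^ d * pb u g + (X 0 ^ d * pb f v + X 0 ^ d * (X 0 ^ d * pb u v)) - pb f g =
    X 0 ^ d * (pb u g + (pb f v + X 0 ^ d * pb u v)) by ring]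
  exact dvd_mul_right _ _

lemma sum_dvd {d j : ℕ} (hj : 1 ≤ j) (hjd : j + 1 ≤ d) (h f : P3) :
    X 0 ^ (j + 1) ∣ (∑ i ∈ Finset.range d, (i.factorial : ℚ)⁻¹ • (DP j h ^ i) f) -
      (f + pb f h * X 0 ^ j) := by
  obtain ⟨e, rfl⟩ : ∃ e, d = e + 2 := ⟨d - 2, by omega⟩
  rw [Finset.sum_range_succ', Finset.sum_range_succ']
  have : ∀ s : P3, s + ((0 + 1).factorial : ℚ)⁻¹ • (DP j h ^ (0 + 1)) f +
      ((0).factorial : ℚ)⁻¹ • (DP j h ^ 0) f - (f + pb f h * X 0 ^ j) = s := by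
    intro s
    simp [DP_apply]; ring
  rw [this]
  refine Finset.dvd_sum fun i _ => ?_
  have h1 : X 0 ^ (j + 1) ∣ (DP j h ^ (i + 1 + 1)) f :=
    (pow_dvd_pow _ (by nlinarith)).trans (DP_pow_dvd j h f _)
  obtain ⟨c, hc⟩ := h1
  exact ⟨((i + 1 + 1).factorial : ℚ)⁻¹ • c, by rw [hc, mul_smul_comm]⟩

lemma surj_part {d j : ℕ} (hj : 1 ≤ j) (hjd : j + 1 ≤ d) (h : P3) (h0 : pderiv 0 h = 0)
    (hc : constantCoeff h = 0) : ∃ φ : Qr d ≃ₐ[ℂ] Qr d, MemA d j φ ∧ RelPhi d j φ h := by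
  obtain ⟨D, hD⟩ := exists_DQ d j h
  obtain ⟨m, hm⟩ := exists_pbQ d
  have hpow : ∀ n f, (D ^ n) (qk d f) = qk d ((DP j h ^ n) f) := by
    intro n
    induction n with
    | zero => intro f; simp
    | succ n ih => intro f; rw [pow_succ, Module.End.mul_apply, hD, ih, pow_succ,
        Module.End.mul_apply]
  have hnil0 : D ^ d = 0 := by
    refine LinearMap.ext fun u => ?_
    obtain ⟨f, rfl⟩ := qk_surj d u
    rw [hpow, LinearMap.zero_apply, qk_zero]
    exact (pow_dvd_pow _ (by nlinarith)).trans (DP_pow_dvd j h f d)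
  have hnil : IsNilpotent D := ⟨d, hnil0⟩
  have hexp : ∀ f, IsNilpotent.exp D (qk d f) =
      qk d (∑ i ∈ Finset.range d, (i.factorial : ℚ)⁻¹ • (DP j h ^ i) f) := by
    intro f
    rw [IsNilpotent.exp_eq_sum hnil0, map_sum, LinearMap.sum_apply]
    refine Finset.sum_congr rfl fun i _ => ?_
    rw [LinearMap.smul_apply, hpow, map_rat_smul]
  have hfix : ∀ f, DP j h f = 0 → IsNilpotent.exp D (qk d f) = qk d f := by
    intro f hf
    have := IsNilpotent.exp_smul_eq_sum (a := D) (m := qk d f) (k := 1)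
      (by rw [pow_one, Module.End.smul_def, hD, hf, map_zero]) hnil
    simpa using this
  have hmul : ∀ u v, IsNilpotent.exp D (u * v) = IsNilpotent.exp D u * IsNilpotent.exp D v := by
    intro u v
    refine exp_bilin D (LinearMap.mul ℂ (Qr d)) ?_ hnil u v
    intro u v
    obtain ⟨f, rfl⟩ := qk_surj d u
    obtain ⟨g, rfl⟩ := qk_surj d v
    simp only [LinearMap.mul_apply']
    rw [← map_mul, hD, hD, hD, DP_mul, map_add, map_mul, map_mul]
  have hbr : ∀ u v, IsNilpotent.exp D (m u v) =
      m (IsNilpotent.exp D u) (IsNilpotent.exp D v) := by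
    refine exp_bilin D m ?_ hnil
    intro u v
    obtain ⟨f, rfl⟩ := qk_surj d u
    obtain ⟨g, rfl⟩ := qk_surj d v
    rw [hm, hD, hD, hD, DP_pb, map_add, hm, hm]
  have hD1 : DP j h 1 = 0 := by simp [DP_apply, pb]
  have hone : IsNilpotent.exp D 1 = 1 := by
    have := hfix 1 hD1
    rwa [map_one] at this
  let e : Qr d ≃ₗ[ℂ] Qr d := LinearEquiv.ofLinear (IsNilpotent.exp D) (IsNilpotent.exp (-D))
    (hnil.exp_mul_exp_neg_self) (hnil.exp_neg_mul_exp_self)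
  let φ : Qr d ≃ₐ[ℂ] Qr d := AlgEquiv.ofLinearEquiv e hone hmul
  have hφ : ∀ u, φ u = IsNilpotent.exp D u := fun u => rfl
  set p : P3 := ∑ i ∈ Finset.range d, (i.factorial : ℚ)⁻¹ • (DP j h ^ i) (X 1) with hp
  set q : P3 := ∑ i ∈ Finset.range d, (i.factorial : ℚ)⁻¹ • (DP j h ^ i) (X 2) with hq
  have e1 : φ (qk d (X 1)) = qk d p := by rw [hφ, hexp]
  have e2 : φ (qk d (X 2)) = qk d q := by rw [hφ, hexp]
  have b1 : pb (X 1) h = pderiv 2 h := by simp [pb, pderiv_X]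
  have b2 : pb (X 2) h = - pderiv 1 h := by simp [pb, pderiv_X]
  have s1 := sum_dvd hj hjd h (X 1)
  have s2 := sum_dvd hj hjd h (X 2)
  rw [← hp, b1] at s1
  rw [← hq, b2] at s2
  refine ⟨φ, ⟨?_, p, q, e1, e2, ⟨1, one_ne_zero, ?_⟩, ?_, ?_⟩, h0, hc, p, q, e1, e2, ?_, ?_⟩
  · rw [hφ, hfix]
    simp [DP_apply, pb, pderiv_X]
  · rw [Idl, Ideal.mem_span_singleton, ← qk_eq, ← hm, ← e1, ← e2, hφ, hφ, ← hbr, hm,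
      show pb (X 1) (X 2) = 1 by simp [pb, pderiv_X], map_one, hone, C_1, map_one]
  · rw [Ideal.mem_span_singleton]
    have := dvd_add ((pow_dvd_pow _ (Nat.le_succ j)).trans s1)
      (dvd_mul_left (X 0 ^ j) (pderiv 2 h))
    convert this using 1; ring
  · rw [Ideal.mem_span_singleton]
    have := dvd_add ((pow_dvd_pow _ (Nat.le_succ j)).trans s2)
      (dvd_mul_left (X 0 ^ j) (- pderiv 1 h))
    convert this using 1; ring
  · rw [Ideal.mem_span_singleton]; exact s1
  · rw [Ideal.mem_span_singleton]
    convert s2 using 1; ring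

/-- The map `Φ_j : Ā_j → (z,t) ⊂ ℂ[z,t]` is a well-defined surjective group
homomorphism with kernel `Ā_{j+1}`; hence `Ā_j/Ā_{j+1}` is isomorphic to the
additive group of the ideal `(z,t)` of `ℂ[z,t]`. -/
theorem Phi_j_hom (d j : ℕ) (hd : 2 ≤ d) (hj1 : 1 ≤ j) (hjd : j ≤ d - 1) :
    (∀ φ : Qr d ≃ₐ[ℂ] Qr d, MemA d j φ → ∃! h, RelPhi d j φ h) ∧
    (∀ (φ ψ : Qr d ≃ₐ[ℂ] Qr d) (h h' : MvPolynomial (Fin 3) ℂ),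
      MemA d j φ → MemA d j ψ → RelPhi d j φ h → RelPhi d j ψ h' →
        RelPhi d j (φ * ψ) (h + h')) ∧
    (∀ (φ : Qr d ≃ₐ[ℂ] Qr d) (h : MvPolynomial (Fin 3) ℂ),
      MemA d j φ → RelPhi d j φ h → (h = 0 ↔ MemA d (j + 1) φ)) ∧
    (∀ h : MvPolynomial (Fin 3) ℂ, pderiv 0 h = 0 → constantCoeff h = 0 →
      ∃ φ : Qr d ≃ₐ[ℂ] Qr d, MemA d j φ ∧ RelPhi d j φ h) := by

  have hjd' : j + 1 ≤ d := by omega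
  refine ⟨fun φ H => ?_, fun φ ψ h h' H _ R R' => relPhi_mul hj1 H R R',
    fun φ h H R => relPhi_ker hjd' H R, fun h h0 hc => surj_part hj1 hjd' h h0 hc⟩
  obtain ⟨h, hh⟩ := relPhi_exists hj1 hjd' H
  exact ⟨h, hh, fun h' hh' => relPhi_unique hjd' hh' hh⟩
end

section
/- Let d ≥ 2 and R̄ = ℂ[x]/(x^d). Then the group Ā_1 of special R̄-automorphisms of R̄[z,t] congruent to the identity mod (x) is generated by the automorphisms exp(x^j·D_h) for j ∈ {1,…,d-1} and h ∈ (z,t) ⊂ ℂ[z,t], where D_h(f) = h_z·f_t - h_t·f_z. -/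
open MvPolynomial

open Finset in
/-- The set of exponential automorphisms `exp(x^j·D_h)` of `R̄[z,t]`, for
`1 ≤ j ≤ d-1` and `h ∈ (z,t) ⊂ ℂ[z,t]`, described by their action on
representatives: `exp(x^j·D_h)(f) = Σ_{n<d} (1/n!)(x^j·D_h)ⁿ(f)` mod `(x^d)`. -/
def ExpGens (d : ℕ) : Set (Qr d ≃ₐ[ℂ] Qr d) :=
  {φ | ∃ j : ℕ, 1 ≤ j ∧ j ≤ d - 1 ∧
    ∃ h : MvPolynomial (Fin 3) ℂ, pderiv 0 h = 0 ∧ constantCoeff h = 0 ∧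
      ∀ f : MvPolynomial (Fin 3) ℂ,
        φ (qk d f) =
          qk d (∑ n ∈ range d,
            ((n.factorial : ℂ)⁻¹) • (fun g => X 0 ^ j * pb h g)^[n] f)}

namespace AbarAux

abbrev P := MvPolynomial (Fin 3) ℂ

lemma qk_surj (d : ℕ) : Function.Surjective (qk d) := Ideal.Quotient.mkₐ_surjective ℂ (Idl d)

lemma qk_eq_zero {d : ℕ} {f : P} : qk d f = 0 ↔ X 0 ^ d ∣ f := by
  rw [qk, Ideal.Quotient.mkₐ_eq_mk, Ideal.Quotient.eq_zero_iff_mem, Idl, Ideal.mem_span_singleton]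

/-- the variable x in the quotient -/
noncomputable abbrev xb (d : ℕ) : Qr d := qk d (X 0)

lemma xb_pow (d : ℕ) : xb d ^ d = 0 := by
  rw [← map_pow, qk_eq_zero]

lemma pderiv_dvd {i : Fin 3} (hi : i ≠ 0) {d : ℕ} {f : P} (h : X 0 ^ d ∣ f) :
    X 0 ^ d ∣ pderiv i f := by
  obtain ⟨g, rfl⟩ := h
  have : pderiv i (X 0 ^ d : P) = 0 := by
    rw [Derivation.leibniz_pow, pderiv_X_of_ne (Ne.symm hi)]; simp
  rw [Derivation.leibniz, this]
  simp

lemma pd_aux {d : ℕ} {i : Fin 3} (hi : i ≠ 0) (f : P) (h : qk d f = 0) :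
    qk d (pderiv i f) = 0 := qk_eq_zero.2 (pderiv_dvd hi (qk_eq_zero.1 h))

/-- descended partial derivatives -/
noncomputable def pd (d : ℕ) (i : Fin 3) (hi : i ≠ 0) : Derivation ℂ (Qr d) (Qr d) :=
  Derivation.liftOfSurjective (d := pderiv i) (qk_surj d) (pd_aux hi)

lemma pd_qk (d : ℕ) (i : Fin 3) (hi : i ≠ 0) (f : P) : pd d i hi (qk d f) = qk d (pderiv i f) :=
  Derivation.liftOfSurjective_apply (qk_surj d) (pd_aux hi) f

noncomputable abbrev d1 (d : ℕ) := pd d 1 (by decide)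
noncomputable abbrev d2 (d : ℕ) := pd d 2 (by decide)

/-- bracket as derivation in the second variable -/
noncomputable def Br (d : ℕ) (f : Qr d) : Derivation ℂ (Qr d) (Qr d) :=
  d1 d f • d2 d - d2 d f • d1 d

lemma Br_apply (d : ℕ) (f g : Qr d) : Br d f g = d1 d f * d2 d g - d2 d f * d1 d g := by
  simp [Br]

lemma Br_swap (d : ℕ) (f g : Qr d) : Br d f g = - Br d g f := by
  simp only [Br_apply]; ring

lemma Br_qk (d : ℕ) (f g : P) : Br d (qk d f) (qk d g) = qk d (pb f g) := by
  simp only [Br_apply, pd_qk, pb, map_sub, map_mul]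

lemma pderiv_comm' (i j : Fin 3) (f : P) : pderiv i (pderiv j f) = pderiv j (pderiv i f) := by
  have : ⁅(pderiv i : Derivation ℂ P P), (pderiv j : Derivation ℂ P P)⁆ = 0 := by
    apply MvPolynomial.derivation_ext
    intro k
    rw [Derivation.commutator_apply]
    simp only [pderiv_X, Pi.single_apply]
    split_ifs <;> simp
  have h := congrArg (fun D => D f) this
  simp only [Derivation.commutator_apply] at h
  simpa [sub_eq_zero] using h

lemma d12 (d : ℕ) (f : Qr d) : d1 d (d2 d f) = d2 d (d1 d f) := by
  obtain ⟨f, rfl⟩ := qk_surj d f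
  rw [pd_qk, pd_qk, pd_qk, pd_qk, pderiv_comm']

lemma Br_jacobi (d : ℕ) (h f g : Qr d) :
    Br d h (Br d f g) = Br d (Br d h f) g + Br d f (Br d h g) := by
  simp only [Br_apply, map_sub, Derivation.leibniz, smul_eq_mul, d12]
  ring

lemma d1_x (d : ℕ) : d1 d (xb d) = 0 := by
  rw [pd_qk, pderiv_X_of_ne (by decide), map_zero]
lemma d2_x (d : ℕ) : d2 d (xb d) = 0 := by
  rw [pd_qk, pderiv_X_of_ne (by decide), map_zero]

lemma Br_x (d : ℕ) (f : Qr d) : Br d f (xb d) = 0 := by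
  simp only [Br_apply, d1_x, d2_x]; ring
lemma Br_x' (d : ℕ) (f : Qr d) : Br d (xb d) f = 0 := by
  simp only [Br_apply, d1_x, d2_x]; ring
lemma Br_xpow (d j : ℕ) (f : Qr d) : Br d f (xb d ^ j) = 0 := by
  rw [Derivation.leibniz_pow, Br_x]; simp
lemma Br_xmul (d j : ℕ) (f g : Qr d) : Br d f (xb d ^ j * g) = xb d ^ j * Br d f g := by
  rw [Derivation.leibniz, Br_xpow]; simp
lemma Br_xmul' (d j : ℕ) (f g : Qr d) : Br d (xb d ^ j * f) g = xb d ^ j * Br d f g := by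
  rw [Br_swap, Br_xmul, Br_swap d g f]; ring

lemma der_ext {d : ℕ} {D E : Derivation ℂ (Qr d) (Qr d)} (h : ∀ i, D (qk d (X i)) = E (qk d (X i))) :
    D = E := by
  ext f
  obtain ⟨f, rfl⟩ := qk_surj d f
  induction f using MvPolynomial.induction_on with
  | C a =>
    have : qk d (C a) = algebraMap ℂ _ a := (qk d).commutes a
    rw [this, Derivation.map_algebraMap, Derivation.map_algebraMap]
  | add p q hp hq => rw [map_add, map_add, map_add, hp, hq]
  | mul_X p i hp => rw [map_mul, Derivation.leibniz, Derivation.leibniz, hp, h]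

/-- Good automorphisms -/
structure Good (d j : ℕ) (φ : Qr d ≃ₐ[ℂ] Qr d) : Prop where
  x : φ (xb d) = xb d
  cong : ∀ f, xb d ^ j ∣ φ f - f
  br : ∀ f g, φ (Br d f g) = Br d (φ f) (φ g)

lemma Good.one (d j : ℕ) : Good d j 1 := ⟨rfl, by simp, fun _ _ => rfl⟩

lemma Good.mul {d j : ℕ} {φ ψ : Qr d ≃ₐ[ℂ] Qr d} (h : Good d j φ) (k : Good d j ψ) :
    Good d j (φ * ψ) := by
  refine ⟨?_, ?_, ?_⟩
  · rw [AlgEquiv.mul_apply, k.x, h.x]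
  · intro f
    rw [AlgEquiv.mul_apply]
    have := dvd_add (h.cong (ψ f)) (k.cong f)
    simpa using this
  · intro f g
    simp only [AlgEquiv.mul_apply, k.br, h.br]

lemma inv_app {d : ℕ} (φ : Qr d ≃ₐ[ℂ] Qr d) (f : Qr d) : φ (φ⁻¹ f) = f := φ.apply_symm_apply f
lemma inv_app' {d : ℕ} (φ : Qr d ≃ₐ[ℂ] Qr d) (f : Qr d) : φ⁻¹ (φ f) = f := φ.symm_apply_apply f

lemma Good.inv {d j : ℕ} {φ : Qr d ≃ₐ[ℂ] Qr d} (h : Good d j φ) : Good d j φ⁻¹ := by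
  refine ⟨?_, ?_, ?_⟩
  · apply φ.injective; rw [inv_app, h.x]
  · intro f
    have := h.cong (φ⁻¹ f)
    rw [inv_app] at this
    rw [← dvd_neg]; simpa using this
  · intro f g
    apply φ.injective
    rw [inv_app, h.br, inv_app, inv_app]

/-- twisted derivation -/
noncomputable def tw {d : ℕ} (φ : Qr d ≃ₐ[ℂ] Qr d) (D : Derivation ℂ (Qr d) (Qr d)) :
    Derivation ℂ (Qr d) (Qr d) :=
  Derivation.mk' (φ.symm.toLinearMap ∘ₗ D.toLinearMap ∘ₗ φ.toLinearMap) (by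
    intro a b
    simp)

lemma tw_apply {d : ℕ} (φ : Qr d ≃ₐ[ℂ] Qr d) (D : Derivation ℂ (Qr d) (Qr d)) (f : Qr d) :
    tw φ D f = φ.symm (D (φ f)) := rfl

lemma Br_12 (d : ℕ) : Br d (qk d (X 1)) (qk d (X 2)) = 1 := by
  rw [Br_qk, pb]
  simp [pderiv_X, Pi.single_apply]
lemma Br_self (d : ℕ) (f : Qr d) : Br d f f = 0 := by
  rw [Br_apply]; ring

lemma br_of_gens {d : ℕ} {φ : Qr d ≃ₐ[ℂ] Qr d} (hx : φ (xb d) = xb d)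
    (h : Br d (φ (qk d (X 1))) (φ (qk d (X 2))) = 1) (f g : Qr d) :
    φ (Br d f g) = Br d (φ f) (φ g) := by
  have key : ∀ i j : Fin 3, Br d (φ (qk d (X i))) (φ (qk d (X j))) =
      φ (Br d (qk d (X i)) (qk d (X j))) := by
    have h' : Br d (φ (qk d (X 2))) (φ (qk d (X 1))) = -1 := by rw [Br_swap, h]
    have h2 : Br d (qk d (X 2)) (qk d (X 1)) = -1 := by rw [Br_swap, Br_12]
    intro i j
    fin_cases i <;> fin_cases j <;>
      simp [hx, Br_x, Br_x', Br_self, h, h', h2, Br_12]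
  have k1 : ∀ i : Fin 3, tw φ (Br d (φ (qk d (X i)))) = Br d (qk d (X i)) := by
    intro i
    apply der_ext
    intro j
    rw [tw_apply, key]; simp
  have k2 : tw φ (Br d (φ g)) = Br d g := by
    apply der_ext
    intro i
    have := congrArg (fun D => D g) (k1 i)
    simp only [tw_apply] at this
    rw [tw_apply, Br_swap, map_neg, this, ← Br_swap]
  have := congrArg (fun D => D f) k2
  simp only [tw_apply] at this
  rw [Br_swap, ← this, Br_swap d (φ f)]
  simp

lemma cong_of_gens {d j : ℕ} {φ : Qr d ≃ₐ[ℂ] Qr d} (hx : φ (xb d) = xb d)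
    (h1 : xb d ^ j ∣ φ (qk d (X 1)) - qk d (X 1)) (h2 : xb d ^ j ∣ φ (qk d (X 2)) - qk d (X 2))
    (f : Qr d) : xb d ^ j ∣ φ f - f := by
  obtain ⟨f, rfl⟩ := qk_surj d f
  induction f using MvPolynomial.induction_on with
  | C a =>
    have : qk d (C a) = algebraMap ℂ _ a := (qk d).commutes a
    rw [this, AlgEquiv.commutes]; simp
  | add p q hp hq =>
    rw [map_add, map_add]
    convert dvd_add hp hq using 1; ring
  | mul_X p i hp =>
    have hi : xb d ^ j ∣ φ (qk d (X i)) - qk d (X i) := by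
      fin_cases i
      · simp [hx]
      · exact h1
      · exact h2
    rw [map_mul, map_mul]
    convert dvd_add (hp.mul_right (φ (qk d (X i)))) (hi.mul_left (qk d p)) using 1
    ring

lemma dvd_qk {d j : ℕ} {f g : P} (h : f - g ∈ Ideal.span {(X 0 : P) ^ j}) :
    xb d ^ j ∣ qk d f - qk d g := by
  rw [Ideal.mem_span_singleton] at h
  rw [← map_sub, ← map_pow]
  exact map_dvd _ h

lemma pb_const {d : ℕ} (hd : 1 ≤ d) {p q : P} {c : ℂ} (h : pb p q - C c ∈ Idl d)
    (hp : p - X 1 ∈ Ideal.span {(X 0 : P) ^ 1}) (hq : q - X 2 ∈ Ideal.span {(X 0 : P) ^ 1}) :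
    c = 1 := by
  rw [Ideal.mem_span_singleton, pow_one] at hp hq
  rw [Idl, Ideal.mem_span_singleton] at h
  obtain ⟨u, hu⟩ := hp
  obtain ⟨v, hv⟩ := hq
  obtain ⟨w, hw⟩ := (dvd_pow_self (X 0 : P) (by omega : d ≠ 0)).trans h
  obtain rfl : p = X 1 + X 0 * u := by rw [← hu]; ring
  obtain rfl : q = X 2 + X 0 * v := by rw [← hv]; ring
  have := congrArg constantCoeff hw
  simp [pb, pderiv_X, Pi.single_apply] at this
  linear_combination -this

lemma good_of_memA {d : ℕ} (hd : 1 ≤ d) {φ : Qr d ≃ₐ[ℂ] Qr d} (h : MemA d 1 φ) : Good d 1 φ := by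
  obtain ⟨hx, p, q, hp, hq, ⟨c, -, hc⟩, h1, h2⟩ := h
  obtain rfl := pb_const hd hc h1 h2
  refine ⟨hx, cong_of_gens hx ?_ ?_, br_of_gens hx ?_⟩
  · rw [hp]; exact dvd_qk h1
  · rw [hq]; exact dvd_qk h2
  · rw [hp, hq, Br_qk, ← sub_eq_zero, ← map_one (qk d), ← map_sub, qk_eq_zero]
    rw [Idl, Ideal.mem_span_singleton] at hc
    simpa using hc

lemma rep {d : ℕ} {f : Qr d} {g : P} (h : xb d ^ 1 ∣ f - qk d g) :
    ∃ p, f = qk d p ∧ p - g ∈ Ideal.span {(X 0 : P) ^ 1} := by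
  obtain ⟨u, hu⟩ := h
  obtain ⟨u, rfl⟩ := qk_surj d u
  refine ⟨g + X 0 * u, ?_, ?_⟩
  · rw [map_add, map_mul]; linear_combination hu
  · rw [Ideal.mem_span_singleton]; simp

lemma memA_of_good {d : ℕ} {φ : Qr d ≃ₐ[ℂ] Qr d} (h : Good d 1 φ) : MemA d 1 φ := by
  obtain ⟨p, hp, hp'⟩ := rep (h.cong (qk d (X 1)))
  obtain ⟨q, hq, hq'⟩ := rep (h.cong (qk d (X 2)))
  refine ⟨h.x, p, q, hp, hq, ⟨1, one_ne_zero, ?_⟩, hp', hq'⟩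
  have := h.br (qk d (X 1)) (qk d (X 2))
  rw [Br_12, map_one, hp, hq, Br_qk] at this
  rw [Idl, Ideal.mem_span_singleton, ← qk_eq_zero, map_sub, ← this, map_one, map_one, sub_self]

/-! exponentials -/

lemma exp_bilin {V : Type*} [AddCommGroup V] [Module ℂ V] [Module ℚ V] (m : V →ₗ[ℂ] V →ₗ[ℂ] V)
    (D : V →ₗ[ℂ] V) (hD : ∀ x y, D (m x y) = m x (D y) + m (D x) y) (hn : IsNilpotent D)
    (x y : V) : IsNilpotent.exp D (m x y) = m (IsNilpotent.exp D x) (IsNilpotent.exp D y) := by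
  let _i : NonUnitalNonAssocRing V :=
    { (inferInstance : AddCommGroup V) with
      mul := fun a b => m a b
      left_distrib := fun a b c => map_add (m a) b c
      right_distrib := fun a b c => by
        change m (a + b) c = m a c + m b c
        simp
      zero_mul := fun a => by
        change m 0 a = 0
        simp
      mul_zero := fun a => map_zero (m a) }
  have : SMulCommClass ℂ V V := ⟨fun r a b => by
    change r • m a b = m a (r • b)
    simp⟩
  have : IsScalarTower ℂ V V := ⟨fun r a b => by
    change m (r • a) b = r • m a b
    simp⟩
  exact Module.End.exp_mul_of_derivation ℂ V D hD hn x y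

/-- x^j D_h -/
noncomputable def Ed (d j : ℕ) (h : Qr d) : Derivation ℂ (Qr d) (Qr d) := xb d ^ j • Br d h

lemma Ed_apply (d j : ℕ) (h f : Qr d) : Ed d j h f = xb d ^ j * Br d h f := rfl

noncomputable abbrev El (d j : ℕ) (h : Qr d) : Module.End ℂ (Qr d) := (Ed d j h).toLinearMap

lemma El_apply (d j : ℕ) (h f : Qr d) : El d j h f = xb d ^ j * Br d h f := rfl

lemma El_pow_dvd (d j n : ℕ) (h f : Qr d) : xb d ^ (j * n) ∣ ((El d j h) ^ n) f := by
  induction n with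
  | zero => simp
  | succ n ih =>
    rw [pow_succ', Module.End.mul_apply, El_apply]
    obtain ⟨g, hg⟩ := ih
    rw [hg, Br_xmul, ← mul_assoc, ← pow_add, mul_add, mul_one, add_comm]
    exact dvd_mul_right _ _

lemma El_nil (d j : ℕ) (hj : 1 ≤ j) (h : Qr d) : (El d j h) ^ d = 0 := by
  refine LinearMap.ext fun f => ?_
  have h1 := El_pow_dvd d j d h f
  have h2 := (pow_dvd_pow (xb d) (Nat.le_mul_of_pos_left d hj)).trans h1
  rw [xb_pow, zero_dvd_iff] at h2
  exact h2

/-- bilinear Poisson bracket -/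
noncomputable def BrL (d : ℕ) : Qr d →ₗ[ℂ] Qr d →ₗ[ℂ] Qr d :=
  LinearMap.mk₂ ℂ (fun f g => Br d f g)
    (fun a b c => by simp only [Br_apply, map_add]; ring)
    (fun r a c => by simp only [Br_apply, Derivation.map_smul, smul_mul_assoc, smul_sub])
    (fun a b c => map_add _ _ _)
    (fun r a c => Derivation.map_smul _ _ _)

noncomputable def expAut (d j : ℕ) (hj : 1 ≤ j) (h : Qr d) : Qr d ≃ₐ[ℂ] Qr d :=
  AlgEquiv.ofLinearEquiv
    (LinearEquiv.ofLinearMap (IsNilpotent.exp (El d j h)) (IsNilpotent.exp (-El d j h))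
      (IsNilpotent.exp_mul_exp_neg_self ⟨d, El_nil d j hj h⟩)
      (IsNilpotent.exp_neg_mul_exp_self ⟨d, El_nil d j hj h⟩))
    (by
      change IsNilpotent.exp (El d j h) 1 = 1
      rcases Nat.eq_zero_or_pos d with rfl | hd
      · have h0 := xb_pow 0
        rw [pow_zero] at h0
        exact eq_of_zero_eq_one h0.symm _ _
      rw [IsNilpotent.exp_eq_sum (El_nil d j hj h), LinearMap.sum_apply,
        Finset.sum_eq_single_of_mem 0 (by simpa using hd)]
      · simp
      · intro b _ hb
        obtain ⟨b, rfl⟩ := Nat.exists_eq_succ_of_ne_zero hb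
        rw [LinearMap.smul_apply, pow_succ, Module.End.mul_apply, El_apply]
        simp)
    (by
      intro x y
      exact exp_bilin (LinearMap.mul ℂ (Qr d)) (El d j h) (fun x y => by
        change Ed d j h (x * y) = x * Ed d j h y + Ed d j h x * y
        rw [Derivation.leibniz]; simp only [smul_eq_mul]; ring) ⟨d, El_nil d j hj h⟩ x y)

lemma expAut_apply (d j : ℕ) (hj : 1 ≤ j) (h f : Qr d) :
    expAut d j hj h f = IsNilpotent.exp (El d j h) f := rfl

lemma expAut_sum (d j : ℕ) (hj : 1 ≤ j) (h f : Qr d) :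
    expAut d j hj h f = ∑ n ∈ Finset.range d, ((n.factorial : ℂ)⁻¹) • ((El d j h) ^ n) f := by
  rw [expAut_apply, IsNilpotent.exp_eq_sum (El_nil d j hj h), LinearMap.sum_apply]
  refine Finset.sum_congr rfl fun n _ => ?_
  rw [LinearMap.smul_apply]
  have : ((n.factorial : ℂ)⁻¹) = (((n.factorial : ℚ)⁻¹ : ℚ) : ℂ) := by push_cast; rfl
  rw [this, Rat.cast_smul_eq_qsmul]

lemma smul_dvd' {d : ℕ} {a b : Qr d} (c : ℂ) (h : a ∣ b) : a ∣ c • b := by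
  obtain ⟨g, rfl⟩ := h
  exact ⟨c • g, (mul_smul_comm c a g).symm⟩

lemma expAut_good (d j : ℕ) (hj : 1 ≤ j) (h : Qr d) : Good d j (expAut d j hj h) := by
  refine ⟨?_, ?_, ?_⟩
  · rcases Nat.eq_zero_or_pos d with rfl | hd
    · have h0 := xb_pow 0
      rw [pow_zero] at h0
      exact eq_of_zero_eq_one h0.symm _ _
    rw [expAut_sum, Finset.sum_eq_single_of_mem 0 (by simpa using hd)]
    · simp
    · intro b _ hb
      obtain ⟨b, rfl⟩ := Nat.exists_eq_succ_of_ne_zero hb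
      rw [pow_succ, Module.End.mul_apply, El_apply, Br_x]
      simp
  · intro f
    rcases Nat.eq_zero_or_pos d with rfl | hd
    · have h0 := xb_pow 0
      rw [pow_zero] at h0
      rw [eq_of_zero_eq_one h0.symm (expAut 0 j hj h f - f) 0]
      exact dvd_zero _
    rw [expAut_sum, ← Finset.sum_erase_add _ _ (Finset.mem_range.2 hd)]
    simp only [Nat.factorial_zero, Nat.cast_one, inv_one, one_smul, pow_zero,
      Module.End.one_apply, add_sub_cancel_right]
    refine Finset.dvd_sum fun n hn => ?_
    have hn0 : n ≠ 0 := Finset.ne_of_mem_erase hn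
    exact smul_dvd' _ ((pow_dvd_pow _ (Nat.le_mul_of_pos_right j (by omega))).trans
      (El_pow_dvd d j n h f))
  · intro f g
    exact exp_bilin (BrL d) (El d j h) (fun x y => by
        change xb d ^ j * Br d h (Br d x y) =
          Br d x (xb d ^ j * Br d h y) + Br d (xb d ^ j * Br d h x) y
        rw [Br_jacobi, Br_xmul, Br_xmul']; ring) ⟨d, El_nil d j hj h⟩ f g

lemma expAut_lin (d j : ℕ) (hd : 2 ≤ d) (hj : 1 ≤ j) (h f : Qr d) :
    xb d ^ (j + 1) ∣ expAut d j hj h f - f - xb d ^ j * Br d h f := by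
  rw [expAut_sum, ← Finset.sum_erase_add _ _ (Finset.mem_range.2 (by omega : 0 < d)),
    ← Finset.sum_erase_add _ _ (Finset.mem_erase.2 ⟨one_ne_zero, Finset.mem_range.2 (by omega : 1 < d)⟩)]
  simp only [Nat.factorial_zero, Nat.cast_one, inv_one, one_smul, pow_zero, Nat.factorial_one,
      Module.End.one_apply, add_sub_cancel_right, pow_one, El_apply]
  refine Finset.dvd_sum fun n hn => ?_
  have hn1 : n ≠ 1 := Finset.ne_of_mem_erase hn
  have hn0 : n ≠ 0 := Finset.ne_of_mem_erase (Finset.mem_of_mem_erase hn)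
  have : j + 1 ≤ j * n := by
    have : j * 2 ≤ j * n := Nat.mul_le_mul_left j (by omega)
    omega
  exact smul_dvd' _ ((pow_dvd_pow _ this).trans (El_pow_dvd d j n h f))

lemma iter_qk (d j : ℕ) (h f : P) (n : ℕ) :
    qk d ((fun g => X 0 ^ j * pb h g)^[n] f) = ((El d j (qk d h)) ^ n) (qk d f) := by
  induction n with
  | zero => simp
  | succ n ih =>
    rw [Function.iterate_succ_apply', pow_succ', Module.End.mul_apply, El_apply, ← ih, Br_qk,
      map_mul, map_pow]

lemma expAut_qk (d j : ℕ) (hj : 1 ≤ j) (h f : P) :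
    expAut d j hj (qk d h) (qk d f) = qk d (∑ n ∈ Finset.range d,
            ((n.factorial : ℂ)⁻¹) • (fun g => X 0 ^ j * pb h g)^[n] f) := by
  rw [expAut_sum, map_sum]
  simp only [map_smul, iter_qk]

lemma good_of_expGens {d : ℕ} {φ : Qr d ≃ₐ[ℂ] Qr d} (h : φ ∈ ExpGens d) : Good d 1 φ := by
  obtain ⟨j, hj, -, h, -, -, hf⟩ := h
  have : φ = expAut d j hj (qk d h) := by
    ext f
    obtain ⟨f, rfl⟩ := qk_surj d f
    rw [hf, expAut_qk]
  rw [this]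
  have := expAut_good d j hj (qk d h)
  refine ⟨this.x, fun f => (pow_dvd_pow _ hj).trans (this.cong f), this.br⟩

/-! Poincare -/

noncomputable def integ (i : Fin 3) : P →ₗ[ℂ] P :=
  (basisMonomials (Fin 3) ℂ).constr ℂ
    (fun s => monomial (s + Finsupp.single i 1) (((s i : ℂ) + 1)⁻¹))

lemma integ_monomial (i : Fin 3) (s : Fin 3 →₀ ℕ) (c : ℂ) :
    integ i (monomial s c) = monomial (s + Finsupp.single i 1) (((s i : ℂ) + 1)⁻¹ * c) := by
  have h : monomial s c = c • basisMonomials (Fin 3) ℂ s := by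
    rw [coe_basisMonomials, smul_monomial, smul_eq_mul, mul_one]
  rw [h, map_smul, integ, Module.Basis.constr_basis, smul_monomial, smul_eq_mul, mul_comm]

lemma pderiv_integ (i : Fin 3) (f : P) : pderiv i (integ i f) = f := by
  induction f using MvPolynomial.induction_on' with
  | monomial s c =>
    rw [integ_monomial, pderiv_monomial]
    have : (s i : ℂ) + 1 ≠ 0 := Nat.cast_add_one_ne_zero _
    congr 1
    · congr 1
      simp
    · simp; field_simp
  | add p q hp hq => rw [map_add, map_add, hp, hq]

lemma pderiv_integ_ne {i j : Fin 3} (hij : i ≠ j) (f : P) :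
    pderiv j (integ i f) = integ i (pderiv j f) := by
  induction f using MvPolynomial.induction_on' with
  | monomial s c =>
    rw [integ_monomial, pderiv_monomial, pderiv_monomial, integ_monomial]
    by_cases hs : s j = 0
    · simp [hs, Finsupp.single_apply, hij]
    congr 1
    · congr 1
      ext k
      by_cases hk : k = j
      · subst hk; simp [Finsupp.single_apply, hij]
      · simp [Finsupp.single_apply, Ne.symm hk]
    · simp [Finsupp.single_apply, hij, Ne.symm hij]; ring
  | add p q hp hq => simp only [map_add, hp, hq]

lemma poincare (a b : P) (ha : pderiv 0 a = 0) (hb : pderiv 0 b = 0)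
    (hab : pderiv 1 a + pderiv 2 b = 0) :
    ∃ h : P, pderiv 0 h = 0 ∧ constantCoeff h = 0 ∧ pderiv 1 h = b ∧ pderiv 2 h = -a := by
  set w := -a - pderiv 2 (integ 1 b) with hw
  set h := integ 1 b + integ 2 w with hh
  have w0 : pderiv 0 w = 0 := by
    rw [hw, map_sub, map_neg, ha, pderiv_comm', pderiv_integ_ne (by decide), hb]; simp
  have w1 : pderiv 1 w = 0 := by
    rw [hw, map_sub, map_neg, pderiv_comm', pderiv_integ]; linear_combination -hab
  refine ⟨h - C (constantCoeff h), ?_, ?_, ?_, ?_⟩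
  · rw [map_sub, pderiv_C, hh, map_add, pderiv_integ_ne (by decide), pderiv_integ_ne (by decide),
      hb, w0]; simp
  · simp
  · rw [map_sub, pderiv_C, hh, map_add, pderiv_integ, pderiv_integ_ne (by decide), w1]; simp
  · rw [map_sub, pderiv_C, hh, map_add, pderiv_integ, hw]; ring

/-- set x to zero -/
noncomputable def s0 : P →ₐ[ℂ] P := aeval ![0, X 1, X 2]

lemma s0_pderiv0 (f : P) : pderiv 0 (s0 f) = 0 := by
  induction f using MvPolynomial.induction_on with
  | C a => simp [s0]
  | add p q hp hq => rw [map_add, map_add, hp, hq, add_zero]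
  | mul_X p i hp =>
    have : pderiv 0 (s0 (X i)) = 0 := by
      fin_cases i <;> simp [s0, pderiv_X, Pi.single_apply]
    rw [map_mul, Derivation.leibniz, hp, this]; simp

lemma s0_pderiv (i : Fin 3) (hi : i ≠ 0) (f : P) : pderiv i (s0 f) = s0 (pderiv i f) := by
  induction f using MvPolynomial.induction_on with
  | C a => simp [s0]
  | add p q hp hq => simp only [map_add, hp, hq]
  | mul_X p k hp =>
    have : pderiv i (s0 (X k)) = s0 (pderiv i (X k)) := by
      fin_cases k <;> fin_cases i <;> simp [s0, pderiv_X, Pi.single_apply] at hi ⊢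
    simp only [map_mul, Derivation.leibniz, hp, this, map_add, smul_eq_mul]

lemma s0_dvd (f : P) : X 0 ∣ f - s0 f := by
  induction f using MvPolynomial.induction_on with
  | C a => simp [s0]
  | add p q hp hq =>
    convert dvd_add hp hq using 1
    rw [map_add]; ring
  | mul_X p i hp =>
    have : X 0 ∣ X i - s0 (X i) := by
      fin_cases i <;> simp [s0]
    convert dvd_add (hp.mul_right (X i)) (this.mul_left (s0 p)) using 1
    rw [map_mul]; ring

lemma step {d j : ℕ} (hj : 1 ≤ j) (hjd : j < d) {φ : Qr d ≃ₐ[ℂ] Qr d} (hφ : Good d j φ) :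
    ∃ e ∈ ExpGens d, Good d (j + 1) (e⁻¹ * φ) := by
  obtain ⟨u, hu⟩ := hφ.cong (qk d (X 1))
  obtain ⟨v, hv⟩ := hφ.cong (qk d (X 2))
  obtain ⟨u, rfl⟩ := qk_surj d u
  obtain ⟨v, rfl⟩ := qk_surj d v
  have hz : φ (qk d (X 1)) = qk d (X 1 + X 0 ^ j * u) := by
    rw [map_add, map_mul, map_pow]; linear_combination hu
  have ht : φ (qk d (X 2)) = qk d (X 2 + X 0 ^ j * v) := by
    rw [map_add, map_mul, map_pow]; linear_combination hv
  have hb := hφ.br (qk d (X 1)) (qk d (X 2))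
  rw [Br_12, map_one, hz, ht, Br_qk] at hb
  have hb' : X 0 ^ d ∣ pb (X 1 + X 0 ^ j * u) (X 2 + X 0 ^ j * v) - 1 := by
    rw [← qk_eq_zero, map_sub, ← hb, map_one, sub_self]
  have px : ∀ i : Fin 3, i ≠ 0 → ∀ f : P, pderiv i (X 0 ^ j * f) = X 0 ^ j * pderiv i f := by
    intro i hi f
    rw [Derivation.leibniz, Derivation.leibniz_pow, pderiv_X_of_ne (Ne.symm hi)]; simp
  have e1 : pb (X 1 + X 0 ^ j * u) (X 2 + X 0 ^ j * v) - 1 =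
      X 0 ^ j * (pderiv 1 u + pderiv 2 v + X 0 ^ j * pb u v) := by
    simp only [pb, map_add, px 1 (by decide), px 2 (by decide)]
    simp [pderiv_X, Pi.single_apply]
    ring
  rw [e1, (by congr 1; omega : (X 0 : P) ^ d = X 0 ^ (j + (d - j))), pow_add,
    mul_dvd_mul_iff_left (pow_ne_zero _ (X_ne_zero _))] at hb'
  have hb2 : X 0 ∣ pderiv 1 u + pderiv 2 v + X 0 ^ j * pb u v :=
    (dvd_pow_self _ (by omega)).trans hb'
  have hab : pderiv 1 (s0 u) + pderiv 2 (s0 v) = 0 := by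
    rw [s0_pderiv 1 (by decide), s0_pderiv 2 (by decide), ← map_add]
    have h3 : X 0 ∣ pderiv 1 u + pderiv 2 v :=
      (dvd_add_left ((dvd_pow_self _ (by omega)).mul_right _)).1 hb2
    have := map_dvd s0 h3
    have s00 : s0 (X 0) = 0 := by simp [s0]
    rwa [s00, zero_dvd_iff] at this
  obtain ⟨h, h0, hc, h1, h2⟩ := poincare _ _ (s0_pderiv0 u) (s0_pderiv0 v) hab
  have hg := expAut_good d j hj (qk d h)
  refine ⟨expAut d j hj (qk d h), ⟨j, hj, by omega, h, h0, hc, expAut_qk d j hj h⟩, ?_⟩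
  have hprod := hg.inv.mul hφ
  have red : ∀ f : Qr d, xb d ^ (j + 1) ∣ φ f - expAut d j hj (qk d h) f →
      xb d ^ (j + 1) ∣ ((expAut d j hj (qk d h))⁻¹ * φ) f - f := by
    intro f hf
    have := map_dvd ((expAut d j hj (qk d h))⁻¹) hf
    rwa [map_pow, hg.inv.x, map_sub, inv_app'] at this
  have fin : ∀ (i : Fin 3) (w : P), φ (qk d (X i)) - qk d (X i) = xb d ^ j * qk d w →
      pb h (X i) = s0 w → 
      xb d ^ (j + 1) ∣ ((expAut d j hj (qk d h))⁻¹ * φ) (qk d (X i)) - qk d (X i) := by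
    intro i w hw hp
    apply red
    have l := expAut_lin d j (by omega) hj (qk d h) (qk d (X i))
    rw [Br_qk, hp] at l
    have m : xb d ^ (j + 1) ∣ xb d ^ j * (qk d (w - s0 w)) := by
      rw [pow_succ]
      exact mul_dvd_mul_left _ (map_dvd (qk d) (s0_dvd w))
    rw [map_sub] at m
    convert dvd_sub m l using 1
    linear_combination hw
  refine ⟨hprod.x, cong_of_gens hprod.x ?_ ?_, hprod.br⟩
  · apply fin 1 u hu
    rw [pb, h1, h2]; simp [pderiv_X, Pi.single_apply]
  · apply fin 2 v hv
    rw [pb, h1, h2]; simp [pderiv_X, Pi.single_apply]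

lemma mem_closure_of_good {d : ℕ} (k : ℕ) : ∀ j, 1 ≤ j → j + k = d → ∀ φ : Qr d ≃ₐ[ℂ] Qr d,
    Good d j φ → φ ∈ Subgroup.closure (ExpGens d) := by
  induction k with
  | zero =>
    rintro j - rfl φ hφ
    have : φ = 1 := by
      ext f
      have := hφ.cong f
      have hz : xb (j + 0) ^ j = 0 := xb_pow (j + 0)
      rw [hz, zero_dvd_iff, sub_eq_zero] at this
      exact this
    rw [this]; exact one_mem _
  | succ k ih =>
    intro j hj hjk φ hφ
    obtain ⟨e, he, hg⟩ := step hj (by omega) hφ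
    have := mul_mem (Subgroup.subset_closure he) (ih (j + 1) (by omega) (by omega) _ hg)
    rwa [mul_inv_cancel_left] at this

end AbarAux

/-- The group `Ā_1` of special automorphisms of `R̄[z,t]` congruent to the
identity mod `(x)` is generated by the exponentials `exp(x^j·D_h)`,
`j ∈ {1,…,d-1}`, `h ∈ (z,t) ⊂ ℂ[z,t]`. -/
theorem Abar_one_generated (d : ℕ) (hd : 2 ≤ d) :
    {φ : Qr d ≃ₐ[ℂ] Qr d | MemA d 1 φ} = ↑(Subgroup.closure (ExpGens d)) := by 
  ext φ
  simp only [Set.mem_ofPred_eq, SetLike.mem_coe]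
  constructor
  · intro h
    exact AbarAux.mem_closure_of_good (d - 1) 1 le_rfl (by omega) φ
      (AbarAux.good_of_memA (by omega) h)
  · intro h
    apply AbarAux.memA_of_good
    induction h using Subgroup.closure_induction with
    | mem x hx => exact AbarAux.good_of_expGens hx
    | one => exact AbarAux.Good.one d 1
    | mul x y _ _ hx hy => exact hx.mul hy
    | inv x _ hx => exact hx.inv
end

section
/- Let r₀ ∈ ℂ[z,t] be a square-free polynomial whose zero set in 𝔸² is connected (e.g. r₀ = z^k + t^l with gcd(k,l)=1). If h₀ ∈ ℂ[z,t] satisfies {r₀,h₀} = (r₀)_z·(h₀)_t - (r₀)_t·(h₀)_z ∈ (r₀), then there exists a constant c ∈ ℂ such that h₀ - c ∈ (r₀). -/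
open MvPolynomial

/-- The Poisson bracket on `ℂ[z,t]`, `z` = variable 0, `t` = variable 1. -/
noncomputable def pb2 (f g : MvPolynomial (Fin 2) ℂ) : MvPolynomial (Fin 2) ℂ :=
  pderiv 0 f * pderiv 1 g - pderiv 1 f * pderiv 0 g

/-- A derivation killing `h` kills everything algebraic over `ℂ[h]` (characteristic zero). -/
theorem aux_der {A : Type} [CommRing A] [IsDomain A] [Algebra ℂ A] (D : Derivation ℂ A A)
    (s : Set A) (hs : ∀ h ∈ s, D h = 0) (a : A)
    (ha : IsAlgebraic (Algebra.adjoin ℂ s) a) : D a = 0 := by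
  classical
  have hk : ∀ x : Algebra.adjoin ℂ s, D (x : A) = 0 := by
    intro x
    have := Derivation.eqOn_adjoin (D1 := D) (D2 := 0) (s := s) (fun y hy => by simp [hs y hy])
    simpa using this x.2
  let L : A →ₗ[Algebra.adjoin ℂ s] A :=
    { toFun := D
      map_add' := fun x y => D.map_add x y
      map_smul' := fun r x => by
        simp [Algebra.smul_def, Derivation.leibniz]
        right
        exact hk r }
  let D' : Derivation (Algebra.adjoin ℂ s) A A :=
    Derivation.mk' L (fun x y => D.leibniz x y)
  have hD' : ∀ x, D' x = D x := fun x => rfl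
  have hex : ∃ n : ℕ, ∃ q : Polynomial (Algebra.adjoin ℂ s),
      q ≠ 0 ∧ Polynomial.aeval a q = 0 ∧ q.natDegree = n := by
    obtain ⟨q, h0, h1⟩ := ha
    exact ⟨_, q, h0, h1, rfl⟩
  obtain ⟨q, h0, h1, hn⟩ := Nat.find_spec hex
  have hmin := fun m hm => Nat.find_min hex (m := m) hm
  have hpos : 0 < q.natDegree := by
    rcases Nat.eq_zero_or_pos q.natDegree with h | h
    · exfalso
      rw [Polynomial.eq_C_of_natDegree_eq_zero h] at h1 h0
      simp only [Polynomial.aeval_C] at h1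
      apply h0
      have : q.coeff 0 = 0 := Subtype.ext h1
      simp [this]
    · exact h
  have hcz : CharZero (Algebra.adjoin ℂ s) :=
    charZero_of_injective_algebraMap (algebraMap ℂ (Algebra.adjoin ℂ s)).injective
  have hder : q.derivative ≠ 0 := by
    intro h
    have := Polynomial.derivative_eq_zero.mp h
    omega
  have hlt : q.derivative.natDegree < q.natDegree := Polynomial.natDegree_derivative_lt hpos.ne'
  have hne : Polynomial.aeval a q.derivative ≠ 0 := by
    intro h
    exact hmin _ (hn ▸ hlt) ⟨_, hder, h, rfl⟩
  have := D'.map_aeval q a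
  rw [h1, map_zero, smul_eq_mul] at this
  rcases mul_eq_zero.mp this.symm with h | h
  · exact absurd h hne
  · exact h

theorem aux_trdeg (p : MvPolynomial (Fin 2) ℂ) (hp : p ≠ 0) (x : Option (Fin 1) → MvPolynomial (Fin 2) ℂ)
    (hx : AlgebraicIndependent ℂ (fun i => Ideal.Quotient.mkₐ ℂ (Ideal.span {p}) (x i))) : False := by
  have hx1 : AlgebraicIndependent ℂ x := AlgebraicIndependent.of_comp (Ideal.Quotient.mkₐ ℂ (Ideal.span {p})) hx
  have hb : IsTranscendenceBasis ℂ x := hx1.isTranscendenceBasis_of_trdeg_le_of_finite (by simp)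
  have halg := hb.isAlgebraic.isAlgebraic p
  obtain ⟨q, hq0, hq⟩ := halg.exists_nonzero_coeff_and_aeval_eq_zero (mem_nonZeroDivisors_of_ne_zero hp)
  apply hq0
  have hdvd : p ∣ ((q.coeff 0 : Algebra.adjoin ℂ (Set.range x)) : MvPolynomial (Fin 2) ℂ) := by
    have h2 := Polynomial.divX_mul_X_add q
    rw [← h2] at hq
    simp only [map_add, map_mul, Polynomial.aeval_X, Polynomial.aeval_C] at hq
    refine ⟨- Polynomial.aeval p q.divX, ?_⟩
    have : algebraMap (Algebra.adjoin ℂ (Set.range x)) (MvPolynomial (Fin 2) ℂ) (q.coeff 0)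
      = ((q.coeff 0 : Algebra.adjoin ℂ (Set.range x)) : MvPolynomial (Fin 2) ℂ) := rfl
    rw [← this]
    linear_combination hq
  have hmem := (Algebra.adjoin_range_eq_range_aeval ℂ x).le (q.coeff 0).2
  obtain ⟨g, hg⟩ := hmem
  have hz : Ideal.Quotient.mkₐ ℂ (Ideal.span {p}) (aeval x g) = 0 := by
    rw [Ideal.Quotient.mkₐ_eq_mk, Ideal.Quotient.eq_zero_iff_mem, Ideal.mem_span_singleton]
    have hg' : aeval x g = _ := hg
    rw [hg']; exact hdvd
  have hz2 : aeval (fun i => Ideal.Quotient.mkₐ ℂ (Ideal.span {p}) (x i)) g = 0 := by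
    rw [← hz, ← AlgHom.comp_apply, MvPolynomial.comp_aeval]
  have hg0 : g = 0 := hx (by rw [hz2, map_zero])
  apply Subtype.ext
  rw [← hg, hg0]; simp

theorem aux_deg (p : MvPolynomial (Fin 2) ℂ) (i : Fin 2) (hd : p ∣ pderiv i p) :
    pderiv i p = 0 := by
  by_contra hne
  obtain ⟨q, hq⟩ := hd
  have hp : p ≠ 0 := by rintro rfl; simp at hne
  have hq0 : q ≠ 0 := by rintro rfl; simp at hq; exact hne hq
  have h1 : p.totalDegree ≤ (pderiv i p).totalDegree := by
    rw [hq, totalDegree_mul_of_isDomain hp hq0]; omega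
  obtain ⟨m, hm, hmd⟩ := Finset.exists_mem_eq_sup (pderiv i p).support
    (by simpa using hne) (fun s => s.sum fun _ e => e)
  have hc : coeff (m + Finsupp.single i 1) p ≠ 0 := by
    intro h
    rw [mem_support_iff, coeff_pderiv, h] at hm
    simp at hm
  have h2 := le_totalDegree (mem_support_iff.mpr hc)
  rw [Finsupp.sum_add_index' (by simp) (by simp)] at h2
  simp only [Finsupp.sum_single_index] at h2
  have h3 : (pderiv i p).totalDegree = m.sum fun _ e => e := hmd
  omega

theorem aux_const (p : MvPolynomial (Fin 2) ℂ) (h : ∀ i, pderiv i p = 0) :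
    p = C (coeff 0 p) := by
  ext m
  rw [coeff_C]
  split_ifs with hm
  · rw [hm]
  · have : ∃ i, m i ≠ 0 := by
      by_contra hcon
      push Not at hcon
      exact hm (by ext i; simp [hcon i])
    obtain ⟨i, hi⟩ := this
    have h1 : m = (m - Finsupp.single i 1) + Finsupp.single i 1 := by
      rw [tsub_add_cancel_of_le]
      simpa [Finsupp.single_le_iff] using Nat.one_le_iff_ne_zero.mpr hi
    have h2 := coeff_pderiv (i := i) p (m - Finsupp.single i 1)
    rw [h i, ← h1, coeff_zero] at h2
    rcases mul_eq_zero.mp h2.symm with h3 | h3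
    · exact h3
    · exact absurd h3 (Nat.cast_add_one_ne_zero _)

theorem aux_irred (p h : MvPolynomial (Fin 2) ℂ) (hp : Prime p) (hb : p ∣ pb2 p h) :
    ∃ c : ℂ, p ∣ h - C c := by
  have : (Ideal.span {p}).IsPrime := (Ideal.span_singleton_prime hp.ne_zero).mpr hp
  let mk := Ideal.Quotient.mkₐ ℂ (Ideal.span {p})
  have hmk : ∀ x, mk x = 0 ↔ p ∣ x := fun x => by
    simp only [mk]
    rw [Ideal.Quotient.mkₐ_eq_mk, Ideal.Quotient.eq_zero_iff_mem, Ideal.mem_span_singleton]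
  have hsurj : Function.Surjective mk := Ideal.Quotient.mkₐ_surjective _ _
  by_cases hal : IsAlgebraic ℂ (mk h)
  · have : IsIntegral ℂ (mk h) := hal.isIntegral
    have h1 := IsAlgClosed.degree_eq_one_of_irreducible ℂ (minpoly.irreducible this)
    have h2 := minpoly.aeval ℂ (mk h)
    rw [Polynomial.eq_X_add_C_of_degree_eq_one h1, (minpoly.monic this).leadingCoeff] at h2
    refine ⟨-(minpoly ℂ (mk h)).coeff 0, ?_⟩
    rw [← hmk, ← h2]
    simp only [map_sub, map_neg, map_add, map_mul, map_one, Polynomial.aeval_C,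
      Polynomial.aeval_X, one_mul, sub_neg_eq_add]
    congr 1
  exfalso
  let D : Derivation ℂ (MvPolynomial (Fin 2) ℂ) (MvPolynomial (Fin 2) ℂ) :=
    pderiv 0 p • pderiv 1 - pderiv 1 p • pderiv 0
  have hD : ∀ x, D x = pb2 p x := fun x => by simp [D, pb2]
  have hker : ∀ x, mk x = 0 → mk (D x) = 0 := by
    intro x hx
    rw [hmk] at hx ⊢
    obtain ⟨y, rfl⟩ := hx
    rw [D.leibniz, hD p]
    have : pb2 p p = 0 := by simp [pb2, mul_comm]
    rw [this]
    simp
  let E := Derivation.liftOfSurjective hsurj hker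
  have hE : ∀ x, E (mk x) = mk (D x) := fun x => Derivation.liftOfSurjective_apply hsurj hker x
  have hEh : E (mk h) = 0 := by rw [hE, hD, hmk]; exact hb
  have hind : AlgebraicIndependent ℂ (fun _ : Fin 1 => mk h) := by
    rw [algebraicIndependent_unique_type_iff]
    exact hal
  have hall : ∀ x, p ∣ D x := by
    intro x
    rw [← hmk, ← hE]
    apply aux_der E (Set.range (fun _ : Fin 1 => mk h)) (by rintro _ ⟨i, rfl⟩; exact hEh)
    by_contra htr
    have := (hind.option_iff_transcendental (mk x)).mpr htr
    apply aux_trdeg p hp.ne_zero (fun o => o.elim x (fun _ => h))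
    convert this using 2 with o
    cases o <;> rfl
  have h0 := hall (X 0)
  have h1 := hall (X 1)
  simp [hD, pb2, pderiv_X] at h0 h1
  have := aux_const p (by
    intro i
    fin_cases i
    · exact aux_deg p _ h1
    · exact aux_deg p _ h0)
  apply hp.not_isUnit
  rw [this]
  have hne : coeff 0 p ≠ 0 := by
    intro h; rw [h, C_0] at this; exact hp.ne_zero this
  exact (isUnit_iff_ne_zero.mpr hne).map C

theorem hamiltonian_tangent_const (r₀ h₀ : MvPolynomial (Fin 2) ℂ)
    (hsf : Squarefree r₀)
    (hconn : IsConnected {p : Fin 2 → ℂ | eval p r₀ = 0})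
    (hbr : pb2 r₀ h₀ ∈ Ideal.span {r₀}) :
    ∃ c : ℂ, h₀ - C c ∈ Ideal.span {r₀} := by
  classical
  have hr : r₀ ≠ 0 := hsf.ne_zero
  rw [Ideal.mem_span_singleton] at hbr
  have hfac : ∀ p, Prime p → p ∣ r₀ → ∃ c : ℂ, p ∣ h₀ - C c := by
    intro p hp hpr
    obtain ⟨q, rfl⟩ := hpr
    apply aux_irred p h₀ hp
    have h1 : p ∣ pb2 (p * q) h₀ := (Dvd.intro _ rfl).trans hbr
    have h2 : pb2 (p * q) h₀ = q * pb2 p h₀ + p * pb2 q h₀ := by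
      simp [pb2, Derivation.leibniz]; ring
    rw [h2, dvd_add_left (Dvd.intro _ rfl)] at h1
    rcases hp.dvd_or_dvd h1 with h | h
    · exact absurd (hsf p (mul_dvd_mul_left p h)) hp.not_isUnit
    · exact h
  choose! c hc using hfac
  let T : Finset ℂ := (UniqueFactorizationMonoid.factors r₀).toFinset.image c
  have hmaps : Set.MapsTo (fun x => eval x h₀) {p : Fin 2 → ℂ | eval p r₀ = 0} (T : Set ℂ) := by
    intro x hx
    have hx : eval x r₀ = 0 := hx
    have hass := UniqueFactorizationMonoid.factors_prod hr
    have h1 : eval x (UniqueFactorizationMonoid.factors r₀).prod = 0 := by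
      obtain ⟨u, hu⟩ := hass.symm
      rw [← hu, map_mul, hx, zero_mul]
    rw [map_multiset_prod, Multiset.prod_eq_zero_iff, Multiset.mem_map] at h1
    obtain ⟨p, hpm, hpx⟩ := h1
    have hd := hc p (UniqueFactorizationMonoid.prime_of_factor p hpm)
      (UniqueFactorizationMonoid.dvd_of_mem_factors hpm)
    obtain ⟨y, hy⟩ := hd
    have : eval x h₀ = c p := by
      have := congrArg (eval x) hy
      simp [hpx] at this
      linear_combination this
    simp only [this]
    exact Finset.mem_coe.mpr (Finset.mem_image_of_mem _ (by simpa using hpm))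
  obtain ⟨x0, hx0⟩ := hconn.nonempty
  refine ⟨eval x0 h₀, ?_⟩
  have hcst : ∀ x, eval x r₀ = 0 → eval x h₀ = eval x0 h₀ := fun x hx =>
    hconn.isPreconnected.constant_of_mapsTo T.finite_toSet.isDiscrete
      (MvPolynomial.continuous_eval h₀).continuousOn hmaps hx hx0
  have hrad : h₀ - C (eval x0 h₀) ∈ (Ideal.span {r₀}).radical := by
    rw [← vanishingIdeal_zeroLocus_eq_radical (K := ℂ), mem_vanishingIdeal_iff]
    intro x hx
    have := hx r₀ (Ideal.mem_span_singleton_self r₀)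
    have := hcst x (by simpa [aeval_eq_eval] using this)
    simp [aeval_eq_eval, this]
  obtain ⟨n, hn⟩ := hrad
  rw [Ideal.mem_span_singleton] at hn ⊢
  exact hsf.isRadical n _ hn
end
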